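/- Let p be a prime and let k ⊆ K, k ⊆ L ⊆ L₁ be subfields of an ambient field F of characteristic p such that the extensions k ⊆ K, k ⊆ L and L ⊆ L₁ are separable. If K is algebraically independent from L₁ over k, then all the extensions K ⊆ KL, KL ⊆ KL₁, L ⊆ KL and L₁ ⊆ KL₁ are separable; in particular the extensions K ⊆ KL ⊆ KL₁ are both separable. -/

import Mathlib

/-- The subfield generated by a subfield `k` and a subset `S` of the ambient field. -/
def Subfield.adjoinSet {F : Type*} [Field F] (k : Subfield F) (S : Set F) : Subfield F :=
  Subfield.closure (↑k ∪ S)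

/-- The subfield of `p`-th powers of a subfield `K`. -/
def Subfield.pPow {F : Type*} [Field F] (p : ℕ) (K : Subfield F) : Subfield F :=
  Subfield.closure ((fun x : F => x ^ p) '' (K : Set F))

/-- `K₁` is linearly disjoint from `K₂` over a common subfield `k₀`: every subset of `K₁`
which is `k₀`-linearly independent remains `K₂`-linearly independent. -/
def LinDisjOver {F : Type*} [Field F] (k₀ K₁ K₂ : Subfield F) : Prop :=
  ∀ S : Set F, S ⊆ (K₁ : Set F) →
    LinearIndependent k₀ (Subtype.val : S → F) →
    LinearIndependent K₂ (Subtype.val : S → F)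

/-- The extension `k ⊆ K` (in characteristic `p`) is separable if `k` is linearly
disjoint from `K^p` over `k^p`. -/
def SepExt {F : Type*} [Field F] (p : ℕ) (k K : Subfield F) : Prop :=
  LinDisjOver (k.pPow p) k (K.pPow p)

/-- A subset `B` is algebraically independent over a subfield `k₀` if no element of `B`
is algebraic over the subfield generated by `k₀` and the other elements of `B`. -/
def AlgIndepOver {F : Type*} [Field F] (k₀ : Subfield F) (B : Set F) : Prop :=
  ∀ b ∈ B, ¬ IsAlgebraic (k₀.adjoinSet (B \ {b})) b

/-- `K` is algebraically independent (free) from `L` over `k`: every subset of `K`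
algebraically independent over `k` remains algebraically independent over `L`. -/
def AlgIndepFrom {F : Type*} [Field F] (k K L : Subfield F) : Prop :=
  ∀ S : Set F, S ⊆ (K : Set F) → AlgIndepOver k S → AlgIndepOver L S

/-- A subset `S` of a subfield `M` is `p`-independent in `M` over `k₀` if no `s ∈ S`
lies in the subfield `M^p · k₀(S ∖ {s})`. -/
def PIndepOver {F : Type*} [Field F] (p : ℕ) (k₀ M : Subfield F) (S : Set F) : Prop :=
  ∀ s ∈ S,
    s ∉ Subfield.closure ((fun x : F => x ^ p) '' (M : Set F) ∪ ↑k₀ ∪ (S \ {s}))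

theorem LinDisjOver.symm {F : Type*} [Field F] {k₀ K₁ K₂ : Subfield F} (h₁ : k₀ ≤ K₁)
    (h₂ : k₀ ≤ K₂) (h : LinDisjOver k₀ K₁ K₂) : LinDisjOver k₀ K₂ K₁ := by
  let A := Subfield.extendScalars h₁
  let B := Subfield.extendScalars h₂
  have key : A.LinearDisjoint B := by
    let b := Module.Basis.ofVectorSpace k₀ A
    refine IntermediateField.LinearDisjoint.of_basis_left b ?_
    have hli : LinearIndependent k₀ (A.val ∘ b) :=
      b.linearIndependent.map' A.val.toLinearMap
        (LinearMap.ker_eq_bot_of_injective A.val.injective)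
    have hinj : Function.Injective (A.val ∘ b) := hli.injective
    have := h (Set.range (A.val ∘ b)) (by rintro _ ⟨i, rfl⟩; exact (b i).2)
      hli.linearIndepOn_id
    exact (linearIndepOn_id_range_iff hinj).mp this
  intro S hS hli
  exact key.symm.linearIndependent_left (a := fun s : S ↦ (⟨s, hS s.2⟩ : B))
    (hli.of_comp B.val.toLinearMap)

theorem SepExt.trans {p : ℕ} {F : Type*} [Field F] {k K M : Subfield F}
    (hkM : k ≤ M) (h : SepExt p k M)
    (h' : SepExt p M K) : SepExt p k K :=
  fun S hS hli ↦ h' S (hS.trans hkM) (h S hS hli)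

section PPow

variable {p : ℕ} {F : Type*} [Field F] [ExpChar F p] {k K : Subfield F}

theorem Subfield.pPow_eq_map (K : Subfield F) : K.pPow p = K.map (frobenius F p) := by
  have : ((fun x : F ↦ x ^ p) '' (K : Set F)) = (K.map (frobenius F p) : Set F) := by
    ext; simp [frobenius_def]
  rw [Subfield.pPow, this, Subfield.closure_eq]

theorem Subfield.mem_pPow {x : F} : x ∈ K.pPow p ↔ ∃ y ∈ K, y ^ p = x := by
  simp [Subfield.pPow_eq_map, frobenius_def]

theorem Subfield.pow_mem_pPow {x : F} (hx : x ∈ K) : x ^ p ∈ K.pPow p :=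
  Subfield.mem_pPow.mpr ⟨x, hx, rfl⟩

theorem Subfield.pPow_mono (h : k ≤ K) : k.pPow p ≤ K.pPow p := by
  rw [Subfield.pPow_eq_map, Subfield.pPow_eq_map]
  exact (Subfield.gc_map_comap (frobenius F p)).monotone_l h

theorem Subfield.pPow_le : k.pPow p ≤ k := fun _ hx ↦ by
  obtain ⟨y, hy, rfl⟩ := Subfield.mem_pPow.mp hx
  exact pow_mem hy p

theorem linearIndependent_pPow_iff {ι : Type*} {v : ι → F} :
    LinearIndependent (k.pPow p) (fun i ↦ v i ^ p) ↔ LinearIndependent k v := by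
  let φ : k → k.pPow p := fun x ↦ ⟨x ^ p, Subfield.pow_mem_pPow x.2⟩
  have hφ : ∀ r (m : F), frobenius F p (r • m) = φ r • frobenius F p m := fun r m ↦ by
    simp [φ, Subfield.smul_def, frobenius_def, mul_pow]
  refine ⟨fun h ↦ ?_, fun h ↦ ?_⟩
  · rw [linearIndependent_iff'] at h ⊢
    intro s g hg i hi
    have := h s (fun i ↦ φ (g i)) ?_ i hi
    · have h0 : (g i : F) ^ p = 0 := congrArg Subtype.val this
      exact Subtype.ext (eq_zero_of_pow_eq_zero h0)
    · have := congrArg (frobenius F p) hg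
      simpa only [map_sum, hφ, map_zero, frobenius_def] using this
  · refine h.map_of_surjective_injective φ (frobenius F p).toAddMonoidHom ?_ ?_ hφ
    · rintro ⟨x, hx⟩
      obtain ⟨y, hy, rfl⟩ := Subfield.mem_pPow.mp hx
      exact ⟨⟨y, hy⟩, rfl⟩
    · exact fun m hm ↦ eq_zero_of_pow_eq_zero hm

/-- MacLane's criterion: `K` is separable over `k` if and only if `p`-th powers preserve
linear independence over `k` of subsets of `K`. -/
theorem sepExt_iff_linearIndependent_pow (hk : k ≤ K) :
    SepExt p k K ↔ ∀ S : Set F, S ⊆ (K : Set F) → LinearIndependent k (Subtype.val : S → F) →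
      LinearIndependent k (fun s : S ↦ (s : F) ^ p) := by
  have hinj (S : Set F) : Function.Injective fun s : S ↦ (s : F) ^ p :=
    (frobenius_inj F p).comp Subtype.val_injective
  refine ⟨fun h S hS hli ↦ ?_, fun h ↦ LinDisjOver.symm (Subfield.pPow_mono hk)
    Subfield.pPow_le fun T hT hli ↦ ?_⟩
  · rw [← linearIndepOn_id_range_iff (hinj S)]
    refine LinDisjOver.symm Subfield.pPow_le (Subfield.pPow_mono hk) h _ ?_ ?_
    · rintro _ ⟨s, rfl⟩
      exact Subfield.pow_mem_pPow (hS s.2)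
    · exact (linearIndepOn_id_range_iff (hinj S)).mpr (linearIndependent_pPow_iff.mpr hli)
  · let S : Set F := {x | x ∈ K ∧ x ^ p ∈ T}
    have hST : Set.range (fun s : S ↦ (s : F) ^ p) = T := by
      ext x
      refine ⟨?_, fun hx ↦ ?_⟩
      · rintro ⟨s, rfl⟩
        exact s.2.2
      · obtain ⟨y, hy, rfl⟩ := Subfield.mem_pPow.mp (hT hx)
        exact ⟨⟨y, hy, hx⟩, rfl⟩
    have hS := h S (fun _ hx ↦ hx.1) (linearIndependent_pPow_iff.mp
      ((linearIndepOn_id_range_iff (hinj S)).mp (hST ▸ hli)))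
    exact hST ▸ (linearIndepOn_id_range_iff (hinj S)).mpr hS

theorem SepExt.of_isSeparable (hk : k ≤ K) (h : ∀ x ∈ K, IsSeparable k x) : SepExt p k K := by
  refine (sepExt_iff_linearIndependent_pow hk).mpr fun S hS hli ↦ ?_
  have : ExpChar k p := (algebraMap k F).expChar (algebraMap k F).injective p
  have := LinearIndependent.map_pow_expChar_pow_of_isSeparable' (F := k) (E := F) p 1
    (fun s : S ↦ h s.1 (hS s.2)) hli
  rw [pow_one] at this
  exact this

theorem SepExt.of_forall_finset
    (h : ∀ T : Finset F, (T : Set F) ⊆ K → ∃ M : Subfield F, (T : Set F) ⊆ M ∧ SepExt p k M) :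
    SepExt p k K := by
  classical
  intro S hS hli
  rw [linearIndependent_iff']
  intro s g hg i hi
  choose a ha hag using fun i ↦ Subfield.mem_pPow.mp (g i).2
  obtain ⟨M, hTM, hM⟩ := h (s.image a) (by
    intro x hx
    obtain ⟨j, -, rfl⟩ := Finset.mem_image.mp hx
    exact ha j)
  have hmem (j) (hj : j ∈ s) : (g j : F) ∈ M.pPow p :=
    hag j ▸ Subfield.pow_mem_pPow (hTM (Finset.mem_image_of_mem a hj))
  have := linearIndependent_iff'.mp (hM S hS hli) s
    (fun j ↦ if hj : j ∈ s then ⟨g j, hmem j hj⟩ else 0) (by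
      rw [← hg]
      refine Finset.sum_congr rfl fun j hj ↦ ?_
      simp [hj, Subfield.smul_def]) i hi
  rw [dif_pos hi, ← ZeroMemClass.coe_eq_zero] at this
  rwa [← ZeroMemClass.coe_eq_zero]

theorem SepExt.adjoin_of_algebraicIndependent {ι : Type*} {v : ι → F}
    (hv : AlgebraicIndependent k v) :
    SepExt p k (IntermediateField.adjoin k (Set.range v)).toSubfield := by
  classical
  have : ExpChar k p := (algebraMap k F).expChar (algebraMap k F).injective p
  have hp : p ≠ 0 := (expChar_pos F p).ne'
  intro S hS hli
  rw [linearIndependent_iff']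
  intro s g hg
  choose a ha hag using fun i ↦ Subfield.mem_pPow.mp (g i).2
  have hrq (i) : ∃ r q : MvPolynomial ι k, MvPolynomial.aeval v q ≠ 0 ∧
      a i * MvPolynomial.aeval v q = MvPolynomial.aeval v r := by
    obtain ⟨r, q, h⟩ := (IntermediateField.mem_adjoin_range_iff k v _).mp (ha i)
    by_cases hq : MvPolynomial.aeval v q = 0
    · exact ⟨0, 1, by simp, by simp [h, hq]⟩
    · exact ⟨r, q, hq, by rw [h, div_mul_cancel₀ _ hq]⟩
  choose r q hq hr using hrq
  let Q := ∏ j ∈ s, q j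
  have hQ : MvPolynomial.aeval v Q ≠ 0 := by
    rw [map_prod]
    exact Finset.prod_ne_zero_iff.mpr fun j _ ↦ hq j
  let R := fun i ↦ r i * ∏ j ∈ s.erase i, q j
  have hR (i) (hi : i ∈ s) : a i * MvPolynomial.aeval v Q = MvPolynomial.aeval v (R i) := by
    rw [map_mul, ← hr, mul_assoc, ← map_mul, Finset.mul_prod_erase s q hi]
  let c : S → k := fun i ↦ ⟨i, hS i.2⟩
  have hsum : ∑ i ∈ s, MvPolynomial.C (c i) * R i ^ p = 0 := by
    refine (injective_iff_map_eq_zero _).mp hv _ ?_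
    calc MvPolynomial.aeval v (∑ i ∈ s, MvPolynomial.C (c i) * R i ^ p)
        = ∑ i ∈ s, (i : F) * (a i * MvPolynomial.aeval v Q) ^ p := by
          rw [map_sum]
          refine Finset.sum_congr rfl fun i hi ↦ ?_
          rw [hR i hi, map_mul, map_pow, MvPolynomial.aeval_C]
          rfl
      _ = (∑ i ∈ s, g i • (i : F)) * MvPolynomial.aeval v Q ^ p := by
          rw [Finset.sum_mul]
          refine Finset.sum_congr rfl fun i hi ↦ ?_
          rw [Subfield.smul_def, ← hag, smul_eq_mul]
          ring
      _ = 0 := by rw [hg, zero_mul]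
  have hcoeff (m : ι →₀ ℕ) : ∀ i ∈ s, (R i).coeff m = 0 := by
    have h := congrArg (MvPolynomial.coeff (p • m)) hsum
    simp only [MvPolynomial.coeff_sum, MvPolynomial.coeff_C_mul,
      ← MvPolynomial.map_frobenius_expand p, MvPolynomial.coeff_map,
      MvPolynomial.coeff_expand_smul p hp, MvPolynomial.coeff_zero, frobenius_def] at h
    intro i hi
    have := linearIndependent_iff'.mp hli s
      (fun i ↦ ⟨(((R i).coeff m : k) : F) ^ p, Subfield.pow_mem_pPow (SetLike.coe_mem _)⟩) (by
        have := congrArg Subtype.val h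
        simpa [c, Subfield.smul_def, mul_comm] using this) i hi
    exact Subtype.ext (eq_zero_of_pow_eq_zero (congrArg Subtype.val this :))
  intro i hi
  have hRi : R i = 0 := MvPolynomial.ext _ _ fun m ↦ hcoeff m i hi
  have hai := hR i hi
  rw [hRi, map_zero, mul_eq_zero, or_iff_left hQ] at hai
  exact Subtype.ext ((hag i).symm.trans (by rw [hai, zero_pow hp]; rfl))

end PPow

section AlgIndep

variable {F : Type*} [Field F] {k K L L₁ : Subfield F}

theorem AlgebraicIndependent.of_subfield_le {ι : Type*} {v : ι → F} (h : k ≤ K)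
    (hv : AlgebraicIndependent K v) : AlgebraicIndependent k v := by
  let := (Subfield.inclusion h).toAlgebra
  have : IsScalarTower k K F := .of_algebraMap_eq fun _ ↦ rfl
  exact hv.restrictScalars (Subfield.inclusion h).injective

theorem Subfield.sup_eq_adjoin (K L : Subfield F) :
    K ⊔ L = (IntermediateField.adjoin L (K : Set F)).toSubfield := by
  refine le_antisymm (sup_le ?_ ?_) (Subfield.closure_le.mpr ?_)
  · exact IntermediateField.subset_adjoin L (K : Set F)
  · exact fun x hx ↦ (IntermediateField.adjoin L (K : Set F)).algebraMap_mem ⟨x, hx⟩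
  · rintro x (⟨y, rfl⟩ | hx)
    · exact (le_sup_right : L ≤ K ⊔ L) y.2
    · exact (le_sup_left : K ≤ K ⊔ L) hx

theorem Subfield.isAlgebraic_adjoinSet_iff {S : Set F} {x : F} :
    IsAlgebraic (k.adjoinSet S) x ↔ IsAlgebraic (Algebra.adjoin k S) x := by
  have : k.adjoinSet S = (IntermediateField.adjoin k S).toSubfield := by
    rw [Subfield.adjoinSet, IntermediateField.adjoin_toSubfield]
    congr 2
    exact (Subtype.range_val).symm
  rw [this]
  exact IntermediateField.isAlgebraic_adjoin_iff

theorem algIndepOver_iff_algebraicIndependent {B : Set F} :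
    AlgIndepOver k B ↔ AlgebraicIndependent k (Subtype.val : B → F) := by
  refine ⟨fun h ↦ algebraicIndependent_of_finite' B (algebraMap k F).injective
    fun t ht _ _ b hb hbt halg ↦ h b hb ?_, fun h b hb halg ↦ ?_⟩
  · rw [Subfield.isAlgebraic_adjoinSet_iff]
    have hle : Algebra.adjoin k t ≤ Algebra.adjoin k (B \ {b}) :=
      Algebra.adjoin_mono (Set.subset_sdiff_singleton ht hbt)
    exact halg.ringHom_of_comp_eq (Subalgebra.inclusion hle).toRingHom (RingHom.id F)
      (Subalgebra.inclusion_injective hle) rfl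
  · have := h.transcendental_adjoin (s := {⟨b, hb⟩}ᶜ) (i := ⟨b, hb⟩) (by simp)
    rw [Set.image_compl_eq_range_sdiff_image Subtype.val_injective, Subtype.range_val,
      Set.image_singleton] at this
    exact this (Subfield.isAlgebraic_adjoinSet_iff.mp halg)

theorem AlgIndepFrom.mono_right (h : AlgIndepFrom k K L₁) (hL : L ≤ L₁) :
    AlgIndepFrom k K L := fun S hS hind ↦
  algIndepOver_iff_algebraicIndependent.mpr <|
    (algIndepOver_iff_algebraicIndependent.mp (h S hS hind)).of_subfield_le hL

theorem AlgIndepFrom.algebraicIndependent {ι : Type*} {v : ι → F} (h : AlgIndepFrom k K L)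
    (hvK : ∀ i, v i ∈ K) (hv : AlgebraicIndependent k v) : AlgebraicIndependent L v := by
  rw [← algebraicIndependent_subtype_range hv.injective,
    ← algIndepOver_iff_algebraicIndependent]
  exact h _ (Set.range_subset_iff.mpr hvK)
    (algIndepOver_iff_algebraicIndependent.mpr hv.to_subtype_range)

/-- If `K` is free from `L₁` over `k` and `k ⊆ L ⊆ L₁`, then `L₁` is free from `KL` over `L`. -/
theorem AlgIndepFrom.sup_right (hkK : k ≤ K) (hkL : k ≤ L) (hLL₁ : L ≤ L₁)
    (h : AlgIndepFrom k K L₁) : AlgIndepFrom L L₁ (K ⊔ L) := by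
  intro S hS hind
  rw [algIndepOver_iff_algebraicIndependent] at hind ⊢
  let := (Subfield.inclusion hkK).toAlgebra
  have : IsScalarTower k K F := .of_algebraMap_eq fun _ ↦ rfl
  let := (Subfield.inclusion hLL₁).toAlgebra
  have : IsScalarTower L L₁ F := .of_algebraMap_eq fun _ ↦ rfl
  obtain ⟨B, hB⟩ := exists_isTranscendenceBasis k K
  let y : B → F := fun b ↦ ((b : K) : F)
  have hy : AlgebraicIndependent L₁ y := h.algebraicIndependent (fun b ↦ (b : K).2)
    (hB.1.map' (f := IsScalarTower.toAlgHom k K F) Subtype.val_injective)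
  have hyS : AlgebraicIndependent L (Sum.elim y (Subtype.val : S → F)) :=
    hind.sumElim_of_tower (S := L₁) (by
      rintro _ ⟨s, rfl⟩
      exact ⟨⟨s, hS s.2⟩, rfl⟩) hy
  have hSy : AlgebraicIndependent L (Sum.elim (Subtype.val : S → F) y) := by
    have := hyS.comp _ (Equiv.sumComm S B).injective
    convert this using 1
    ext (_ | _) <;> rfl
  let M := IntermediateField.adjoin L (Set.range y)
  have hM : AlgebraicIndependent M (Subtype.val : S → F) :=
    IntermediateField.algebraicIndependent_adjoin_iff.mpr
      (AlgebraicIndependent.sumElim_iff.mp hSy).2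
  have hle : K ⊔ L ≤ (algebraicClosure M F).toSubfield := by
    refine sup_le (fun x hx ↦ ?_) fun x hx ↦ ?_
    · have := hB.isAlgebraic
      have hmem (a : Algebra.adjoin k (Set.range (Subtype.val : B → K))) : ((a : K) : F) ∈ M := by
        refine Algebra.adjoin_induction (p := fun (a : K) _ ↦ (a : F) ∈ M) ?_ (fun r ↦ ?_)
          (fun _ _ _ _ ↦ add_mem) (fun _ _ _ _ ↦ mul_mem) a.2
        · rintro _ ⟨b, rfl⟩
          exact IntermediateField.subset_adjoin L _ ⟨b, rfl⟩
        · exact M.algebraMap_mem ⟨r, hkL r.2⟩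
      let f : Algebra.adjoin k (Set.range (Subtype.val : B → K)) →+* M :=
        (K.subtype.comp (Subalgebra.val _).toRingHom).codRestrict M hmem
      exact mem_algebraicClosure_iff.mpr <|
        (Algebra.IsAlgebraic.isAlgebraic (⟨x, hx⟩ : K)).ringHom_of_comp_eq f K.subtype
          (fun _ _ hab ↦ Subtype.ext (Subtype.ext (congrArg (algebraMap M F) hab))) rfl
    · exact (algebraicClosure M F).algebraMap_mem ⟨x, M.algebraMap_mem ⟨x, hx⟩⟩
  exact AlgebraicIndependent.of_subfield_le hle hM.algebraicClosure

end AlgIndep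

theorem IsSeparable.ringHom_of_comp_eq {R S A B : Type*} [Field R] [Field S] [CommRing A] [Ring B]
    [Algebra R A] [Algebra S B] {a : A} (ha : IsSeparable R a) (f : R →+* S) (g : A →+* B)
    (h : (algebraMap S B).comp f = g.comp (algebraMap R A)) : IsSeparable S (g a) := by
  refine (Polynomial.Separable.map (f := f) ha).of_dvd (minpoly.dvd S (g a) ?_)
  rw [← Polynomial.map_aeval_eq_aeval_map h, minpoly.aeval, map_zero]

section Compositum

variable {p : ℕ} {F : Type*} [Field F] [ExpChar F p] {k K L : Subfield F}

theorem SepExt.exists_algebraicIndependent_isSeparable (hp : p.Prime) (hkK : k ≤ K)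
    (h : SepExt p k K) {T : Finset F} (hT : (T : Set F) ⊆ K) :
    ∃ B : Set F, B ⊆ K ∧ AlgebraicIndependent k (Subtype.val : B → F) ∧
      ∀ x ∈ T, IsSeparable (IntermediateField.adjoin k B) x := by
  let E := IntermediateField.adjoin k (T : Set F)
  have hEK : E.toSubfield ≤ K := by
    rw [← Subfield.extendScalars_toSubfield hkK]
    exact (IntermediateField.adjoin_le_iff (T := Subfield.extendScalars hkK)).mpr hT
  have : ExpChar k p := (algebraMap k F).expChar (algebraMap k F).injective p
  have : Algebra.EssFiniteType k E := IntermediateField.essFiniteType_iff.mpr ⟨T, rfl⟩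
  obtain ⟨s, hs, hsep⟩ :=
    exists_isTranscendenceBasis_and_isSeparable_of_linearIndepOn_pow_of_essFiniteType
      (k := k) (K := E) p hp fun s hs ↦ by
    have hli : LinearIndependent k (fun x : s ↦ ((x : E) : F)) :=
      LinearIndependent.map' hs E.val.toLinearMap
        (LinearMap.ker_eq_bot_of_injective E.val.injective)
    have hpow := (sepExt_iff_linearIndependent_pow hkK).mp h _
      (Set.range_subset_iff.mpr fun x : s ↦ hEK (x : E).2) hli.linearIndepOn_id
    exact LinearIndependent.of_comp E.val.toLinearMap
      (hpow.comp (Set.rangeFactorization fun x : s ↦ ((x : E) : F))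
        (Set.rangeFactorization_injective.mpr hli.injective))
  refine ⟨E.val '' s, Set.image_subset_iff.mpr fun x _ ↦ hEK x.2, ?_, fun x hx ↦ ?_⟩
  · refine (hs.1.map' (f := E.val) E.val.injective).to_subtype_range' ?_
    rw [Set.range_comp, Subtype.range_coe]
  · have hmem (a : IntermediateField.adjoin k (s : Set E)) :
        ((a : E) : F) ∈ IntermediateField.adjoin k (E.val '' s) := by
      rw [← IntermediateField.adjoin_map]
      exact ⟨a, a.2, rfl⟩
    let f : IntermediateField.adjoin k (s : Set E) →+* IntermediateField.adjoin k (E.val '' s) :=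
      (E.val.toRingHom.comp (IntermediateField.val _).toRingHom).codRestrict _ hmem
    exact (hsep.isSeparable' ⟨x, IntermediateField.subset_adjoin k _ hx⟩).ringHom_of_comp_eq
      f E.val.toRingHom rfl

/-- If `K` is separable over `k` and free from `L` over `k`, then `KL` is separable over `L`. -/
theorem SepExt.sup_right (hp : p.Prime) (hkK : k ≤ K) (hkL : k ≤ L) (h : SepExt p k K)
    (hfree : AlgIndepFrom k K L) : SepExt p L (K ⊔ L) := by
  classical
  refine SepExt.of_forall_finset fun T hT ↦ ?_
  rw [Subfield.sup_eq_adjoin] at hT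
  choose! U hUK hU using fun x (hx : x ∈ T) ↦
    IntermediateField.exists_finset_of_mem_adjoin (hT hx)
  obtain ⟨B, hBK, hB, hsep⟩ := h.exists_algebraicIndependent_isSeparable hp hkK
    (T := T.biUnion U) (by simpa using hUK)
  let N := (IntermediateField.adjoin L B).toSubfield
  have hLN : L ≤ N := fun x hx ↦ (IntermediateField.adjoin L B).algebraMap_mem ⟨x, hx⟩
  have hN : SepExt p L N := by
    have := SepExt.adjoin_of_algebraicIndependent (p := p)
      (hfree.algebraicIndependent (fun b ↦ hBK b.2) hB)
    rwa [Subtype.range_val] at this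
  let M := IntermediateField.adjoin N (T.biUnion U : Set F)
  have hNM : N ≤ M.toSubfield := fun x hx ↦ M.algebraMap_mem ⟨x, hx⟩
  have hkN : (IntermediateField.adjoin k B).toSubfield ≤ N := by
    rw [IntermediateField.adjoin_toSubfield, Subfield.closure_le]
    rintro x (⟨y, rfl⟩ | hx)
    · exact hLN (hkL y.2)
    · exact IntermediateField.subset_adjoin L B hx
  refine ⟨M.toSubfield, fun x hx ↦ ?_,
    hN.trans hLN (SepExt.of_isSeparable hNM fun x hx ↦ ?_)⟩
  · have hLM : (IntermediateField.adjoin L (U x : Set F)).toSubfield ≤ M.toSubfield := by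
      rw [IntermediateField.adjoin_toSubfield, Subfield.closure_le]
      rintro z (⟨y, rfl⟩ | hz)
      · exact hNM (hLN y.2)
      · exact IntermediateField.subset_adjoin N _ (Finset.mem_biUnion.mpr ⟨x, hx, hz⟩)
    exact hLM (hU x hx)
  · have hM : M ≤ separableClosure N F := IntermediateField.adjoin_le_iff.mpr fun x hx ↦
      (hsep x hx).ringHom_of_comp_eq (Subfield.inclusion hkN) (RingHom.id F) rfl
    exact hM hx

end Compositum

/-- If `k ⊆ K`, `k ⊆ L ⊆ L₁` with `k ⊆ K`, `k ⊆ L` and `L ⊆ L₁` separable, and `K` is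
algebraically independent from `L₁` over `k`, then the extensions `K ⊆ KL`,
`KL ⊆ KL₁`, `L ⊆ KL` and `L₁ ⊆ KL₁` are all separable. -/
theorem sepExt_tower_of_algIndepFrom
    {p : ℕ} (hp : p.Prime) {F : Type*} [Field F] [CharP F p]
    (k K L L₁ : Subfield F) (hkK : k ≤ K) (hkL : k ≤ L) (hLL₁ : L ≤ L₁)
    (hsK : SepExt p k K) (hsL : SepExt p k L) (hsL₁ : SepExt p L L₁)
    (hfree : AlgIndepFrom k K L₁) :
    SepExt p K (K ⊔ L) ∧ SepExt p (K ⊔ L) (K ⊔ L₁) ∧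
      SepExt p L (K ⊔ L) ∧ SepExt p L₁ (K ⊔ L₁) := by
  have : ExpChar F p := .prime hp
  have hkL₁ := hkL.trans hLL₁
  have hfree' : AlgIndepFrom k L K := fun S hS ↦ by
    have := hfree.sup_right hkK le_rfl hkL₁ S (hS.trans hLL₁)
    rwa [sup_eq_left.mpr hkK] at this
  refine ⟨?_, ?_, hsK.sup_right hp hkK hkL (hfree.mono_right hLL₁),
    hsK.sup_right hp hkK hkL₁ hfree⟩
  · rw [sup_comm]
    exact hsL.sup_right hp hkL hkK hfree'
  · have := hsL₁.sup_right hp hLL₁ le_sup_right (hfree.sup_right hkK hkL hLL₁)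
    rwa [sup_left_comm, sup_eq_left.mpr hLL₁] at this
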